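/- (Theorem 1, part IV.) Let t̄₁ ≤ t̄₂ be natural numbers and suppose the series Σ_{j=0}^∞ ω^{(t̄₁)}(j)·c_j and Σ_{j=0}^∞ ω^{(t̄₂)}(j)·c_j both converge. Then the averaged expected error covariance is monotonically nondecreasing in the threshold: Σ_{j=0}^∞ ω^{(t̄₁)}(j)·c_j ≤ Σ_{j=0}^∞ ω^{(t̄₂)}(j)·c_j. -/

import Mathlib

open Matrix Filter

open Finset in
/-- Partial sums of a sequence with a delayed linear recurrence satisfy an integrated recurrence. -/
lemma sum_range_succ_of_delay_recurrence {α β : ℝ} {t : ℕ} {a s : ℕ → ℝ}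
    (h : ∀ j, a (j + 1) = α * a j + (if t ≤ j then β * a (j - t) else 0) + s j) (m : ℕ) :
    ∑ l ∈ range (m + 1), a l =
      a 0 + α * ∑ l ∈ range m, a l + β * ∑ l ∈ range (m - t), a l + ∑ l ∈ range m, s l := by
  induction m with
  | zero => simp
  | succ m ih =>
    have ha := sum_range_succ a m
    rw [sum_range_succ a (m + 1), h m, sum_range_succ s m]
    split_ifs with htm
    · rw [Nat.sub_add_comm htm, sum_range_succ a (m - t)]
      linear_combination ih - α * ha
    · rw [Nat.sub_eq_zero_of_le (by lia : m ≤ t)] at ih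
      rw [Nat.sub_eq_zero_of_le (by lia : m + 1 ≤ t)]
      linear_combination ih - α * ha

open Finset in
/-- If the probability weights `q` stochastically dominate `p`, then the `q`-average of a
nonnegative monotone function is at least its `p`-average. -/
lemma tsum_mul_le_tsum_mul_of_sum_range_le {p q c : ℕ → ℝ} {M : ℝ}
    (hp : ∀ j, 0 ≤ p j) (hq : ∀ j, 0 ≤ q j) (hpM : ∀ m, ∑ j ∈ range m, p j ≤ M)
    (hqM : HasSum q M) (hqp : ∀ m, ∑ j ∈ range m, q j ≤ ∑ j ∈ range m, p j)
    (hc0 : 0 ≤ c 0) (hc : Monotone c) (hqc : Summable fun j => q j * c j) :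
    ∑' j, p j * c j ≤ ∑' j, q j * c j := by
  have hcn : ∀ j, 0 ≤ c j := fun j => hc0.trans (hc j.zero_le)
  have abel : ∀ N, ∑ j ∈ range N, p j * c j ≤ ∑ j ∈ range N, q j * c j +
      (∑ j ∈ range N, p j - ∑ j ∈ range N, q j) * c N := by
    intro N
    induction N with
    | zero => simp
    | succ N ih =>
      have step := mul_le_mul_of_nonneg_left (hc N.le_succ) (sub_nonneg.2 (hqp (N + 1)))
      simp only [sum_range_succ, Nat.succ_eq_add_one] at step ⊢
      linarith
  refine Real.tsum_le_of_sum_range_le (fun j => mul_nonneg (hp j) (hcn j)) fun N => ?_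
  have hmass := hqM.summable.sum_add_tsum_nat_add N
  rw [hqM.tsum_eq] at hmass
  have tail : (∑' j, q (j + N)) * c N ≤ ∑' j, q (j + N) * c (j + N) := by
    rw [← tsum_mul_right]
    refine Summable.tsum_le_tsum
      (fun j => mul_le_mul_of_nonneg_left (hc (Nat.le_add_left N j)) (hq _))
      (((summable_nat_add_iff N).2 hqM.summable).mul_right _)
      ((summable_nat_add_iff (f := fun j => q j * c j) N).2 hqc)
  have bound : (∑ j ∈ range N, p j - ∑ j ∈ range N, q j) * c N ≤
      (∑' j, q (j + N)) * c N :=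
    mul_le_mul_of_nonneg_right (by linarith [hpM N]) (hcn N)
  linarith [abel N, hqc.sum_add_tsum_nat_add N]

/-- Iterates of `X ↦ A X Aᵀ + Q` started from a sub-solution increase in the Loewner order. -/
lemma posSemidef_iterate_succ_sub {n : ℕ} {A Q P : Matrix (Fin n) (Fin n) ℝ}
    (h : (A * P * Aᵀ + Q - P).PosSemidef) (j : ℕ) :
    ((fun X => A * X * Aᵀ + Q)^[j + 1] P - (fun X => A * X * Aᵀ + Q)^[j] P).PosSemidef := by
  induction j with
  | zero => simpa using h
  | succ j ih =>
    rw [Function.iterate_succ_apply', Function.iterate_succ_apply' _ j]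
    have key := ih.mul_mul_conjTranspose_same A
    rw [conjTranspose_eq_transpose_of_trivial, Matrix.mul_sub, Matrix.sub_mul,
      Function.iterate_succ_apply'] at key
    rwa [add_sub_add_right_eq_sub]

lemma monotone_trace_iterate {n : ℕ} {A Q P : Matrix (Fin n) (Fin n) ℝ}
    (h : (A * P * Aᵀ + Q - P).PosSemidef) :
    Monotone fun j => ((fun X => A * X * Aᵀ + Q)^[j] P).trace := by
  refine monotone_nat_of_le_succ fun j => ?_
  have := (posSemidef_iterate_succ_sub h j).trace_nonneg
  rwa [trace_sub, sub_nonneg] at this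

open Finset in
/-- The weights `ω` satisfy a delayed linear recurrence not involving `φ`. -/
lemma weight_delay_recurrence {lam lam_e : ℝ} {t : ℕ} {φ ω : ℕ → ℝ}
    (hφ1 : ∀ j, j < t → φ (j + 1) = (1 - lam) * (1 - lam_e) * φ j)
    (hφ2 : ∀ j, t ≤ j → φ (j + 1) =
      (1 - lam) * (1 - lam_e) * φ j + lam * (1 - lam_e) * φ (j - t))
    (hφω : φ 0 = lam * ω 0)
    (hω1 : ∀ j, 1 ≤ j → j ≤ t → ω j = (1 - lam) * (1 - lam_e) * ω (j - 1) + φ 0)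
    (hω2 : ∀ j, t + 1 ≤ j → ω j = (1 - lam) * (1 - lam_e) * ω (j - 1) + φ 0
        - lam_e * ∑ l ∈ range (j - t), φ l) (j : ℕ) :
    ω (j + 1) = (1 - lam) * (1 - lam_e) * ω j +
      (if t ≤ j then lam * (1 - lam_e) * ω (j - t) else 0) +
      (if j < t then lam * ω 0 else 0) := by
  have sumφ := sum_range_succ_of_delay_recurrence (α := (1 - lam) * (1 - lam_e))
    (β := lam * (1 - lam_e)) (t := t) (a := φ) (s := fun _ => 0) (fun j => by
      split_ifs with h
      · rw [hφ2 j h, add_zero]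
      · rw [hφ1 j (by lia), add_zero, add_zero])
  have key : ∀ k, lam * (1 - lam_e) * ω k = φ 0 - lam_e * ∑ l ∈ range (k + 1), φ l := by
    intro k
    induction k with
    | zero => rw [zero_add, sum_range_one, hφω]; ring
    | succ k ih =>
      rw [sumφ (k + 1), sum_const_zero]
      rcases lt_or_ge k t with h | h
      · rw [hω1 (k + 1) (by lia) h, Nat.sub_eq_zero_of_le h, add_tsub_cancel_right, sum_range_zero]
        linear_combination (1 - lam) * (1 - lam_e) * ih
      · rw [hω2 (k + 1) (by lia), add_tsub_cancel_right]
        linear_combination (1 - lam) * (1 - lam_e) * ih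
  rcases lt_or_ge j t with h | h
  · rw [hω1 (j + 1) (by lia) h, if_neg (by lia), if_pos h, hφω, add_tsub_cancel_right, add_zero]
  · rw [hω2 (j + 1) (by lia), if_pos h, if_neg (by lia), key, Nat.sub_add_comm h,
      add_tsub_cancel_right]
    ring

open Finset in
lemma sum_range_ite_lt_const (t m : ℕ) (b : ℝ) :
    ∑ j ∈ range m, (if j < t then b else 0) = (min m t : ℕ) * b := by
  induction m with
  | zero => simp
  | succ m ih =>
    rw [sum_range_succ, ih]
    split_ifs with h
    · rw [min_eq_left h.le, min_eq_left (by lia : m + 1 ≤ t)]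
      push_cast
      ring
    · rw [min_eq_right (by lia : t ≤ m), min_eq_right (by lia : t ≤ m + 1), add_zero]

/-- The integrated source term decreases in the threshold. -/
lemma source_antitone {lam lam_e : ℝ} (hlam : 0 < lam) (hle : 0 < lam_e) {s t : ℕ}
    (hst : s ≤ t) (m : ℕ) :
    lam_e / (lam * t + 1) * (1 + lam * (min m t : ℕ)) ≤
      lam_e / (lam * s + 1) * (1 + lam * (min m s : ℕ)) := by
  have hs : 0 < lam * (s : ℝ) + 1 := by positivity
  have ht : 0 < lam * (t : ℝ) + 1 := by positivity
  have hst' : (s : ℝ) ≤ t := by exact_mod_cast hst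
  rw [div_mul_eq_mul_div, div_mul_eq_mul_div, div_le_div_iff₀ ht hs, mul_assoc, mul_assoc]
  refine mul_le_mul_of_nonneg_left ?_ hle.le
  rcases le_total m s with h | h
  · rw [min_eq_left h, min_eq_left (h.trans hst)]
    gcongr
  · rw [min_eq_right h, mul_comm, add_comm 1 (lam * (s : ℝ)), add_comm 1]
    gcongr
    exact min_le_right m t

/-- Theorem 1, part IV: the averaged expected error covariance
`∑' j, ω^{(t̄)}(j) · c j` is monotonically nondecreasing in the threshold. -/
theorem average_covariance_monotone_in_threshold
    (lam lam_e : ℝ) (hlam0 : 0 < lam) (hlam1 : lam < 1)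
    (hle0 : 0 < lam_e) (hle1 : lam_e < 1)
    (φ : ℕ → ℕ → ℝ)
    (hφ0 : ∀ t : ℕ, φ t 0 = lam * lam_e / (lam * (t : ℝ) + 1))
    (hφ1 : ∀ t : ℕ, ∀ j, j < t → φ t (j + 1) = (1 - lam) * (1 - lam_e) * φ t j)
    (hφ2 : ∀ t : ℕ, ∀ j, t ≤ j → φ t (j + 1) =
      (1 - lam) * (1 - lam_e) * φ t j + lam * (1 - lam_e) * φ t (j - t))
    (ω : ℕ → ℕ → ℝ)
    (hω0 : ∀ t : ℕ, ω t 0 = lam_e / (lam * (t : ℝ) + 1))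
    (hω1 : ∀ t : ℕ, ∀ j, 1 ≤ j → j ≤ t →
      ω t j = (1 - lam) * (1 - lam_e) * ω t (j - 1) + φ t 0)
    (hω2 : ∀ t : ℕ, ∀ j, t + 1 ≤ j →
      ω t j = (1 - lam) * (1 - lam_e) * ω t (j - 1) + φ t 0
        - lam_e * ∑ l ∈ Finset.range (j - t), φ t l)
    (n : ℕ) (hn : 0 < n)
    (A Q Pbar : Matrix (Fin n) (Fin n) ℝ)
    (hQ : Q.PosSemidef) (hP : Pbar.PosSemidef)
    (hloewner : (A * Pbar * Aᵀ + Q - Pbar).PosSemidef)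
    (c : ℕ → ℝ) (hc : ∀ j, c j = ((fun X => A * X * Aᵀ + Q)^[j] Pbar).trace)
    (t1 t2 : ℕ) (h12 : t1 ≤ t2)
    (hsum1 : Summable fun j : ℕ => ω t1 j * c j)
    (hsum2 : Summable fun j : ℕ => ω t2 j * c j) :
    ∑' j : ℕ, ω t1 j * c j ≤ ∑' j : ℕ, ω t2 j * c j := by
  have hω_succ := fun t => weight_delay_recurrence (hφ1 t) (hφ2 t)
    (by rw [hφ0, hω0, mul_div_assoc]) (hω1 t) (hω2 t)
  have hα : 0 ≤ (1 - lam) * (1 - lam_e) := mul_nonneg (by linarith) (by linarith)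
  have hβ : 0 ≤ lam * (1 - lam_e) := mul_nonneg hlam0.le (by linarith)
  have hω_nonneg : ∀ t j, 0 ≤ ω t j := by
    intro t j
    have h0 : 0 ≤ ω t 0 := by rw [hω0]; positivity
    induction j using Nat.strong_induction_on with
    | _ j ih =>
      cases j with
      | zero => exact h0
      | succ j =>
        rw [hω_succ t j]
        have h1 := mul_nonneg hα (ih j j.lt_succ_self)
        have h2 := mul_nonneg hβ (ih (j - t) (by lia))
        have h3 := mul_nonneg hlam0.le h0
        split_ifs <;> linarith
  set F : ℕ → ℕ → ℝ := fun t m => ∑ j ∈ Finset.range m, ω t j with hF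
  have F_succ : ∀ t m, F t (m + 1) = (1 - lam) * (1 - lam_e) * F t m +
      lam * (1 - lam_e) * F t (m - t) +
      lam_e / (lam * (t : ℝ) + 1) * (1 + lam * (min m t : ℕ)) := by
    intro t m
    have := sum_range_succ_of_delay_recurrence (hω_succ t) m
    rw [sum_range_ite_lt_const, hω0] at this
    simp only [hF]
    rw [this]
    ring
  have F_mono : ∀ t, Monotone (F t) := fun t => monotone_nat_of_le_succ fun m => by
    simp only [hF, Finset.sum_range_succ]
    linarith [hω_nonneg t m]
  have source_le : ∀ t m : ℕ,
      lam_e / (lam * (t : ℝ) + 1) * (1 + lam * (min m t : ℕ)) ≤ lam_e := by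
    intro t m
    simpa using source_antitone hlam0 hle0 t.zero_le m
  have F_le_one : ∀ t m, F t m ≤ 1 := by
    intro t m
    induction m with
    | zero => simp [hF]
    | succ m ih =>
      rw [F_succ]
      have h1 := mul_le_mul_of_nonneg_left ih hα
      have h2 := mul_le_mul_of_nonneg_left ((F_mono t (Nat.sub_le m t)).trans ih) hβ
      linarith [source_le t m]
  have F_antitone : ∀ m, F t2 m ≤ F t1 m := by
    intro m
    induction m using Nat.strong_induction_on with
    | _ m ih =>
      cases m with
      | zero => simp [hF]
      | succ m =>
        rw [F_succ, F_succ]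
        have h1 := mul_le_mul_of_nonneg_left (ih m m.lt_succ_self) hα
        have h2 := mul_le_mul_of_nonneg_left
          ((ih (m - t2) (by lia)).trans (F_mono t1 (Nat.sub_le_sub_left h12 m))) hβ
        linarith [source_antitone hlam0 hle0 h12 m]
  have hasSum_one : HasSum (ω t2) 1 := by
    have hs : Summable (ω t2) := summable_of_sum_range_le (hω_nonneg t2) (F_le_one t2)
    have lim : Tendsto (F t2) atTop (nhds (∑' j, ω t2 j)) := hs.hasSum.tendsto_sum_nat
    have lim' : Tendsto (fun m => F t2 (m + 1)) atTop
        (nhds ((1 - lam) * (1 - lam_e) * ∑' j, ω t2 j +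
          lam * (1 - lam_e) * ∑' j, ω t2 j + lam_e)) := by
      refine (((lim.const_mul _).add
        ((lim.comp (tendsto_sub_atTop_nat t2)).const_mul _)).add_const lam_e).congr' ?_
      filter_upwards [eventually_ge_atTop t2] with m hm
      have : lam * (t2 : ℝ) + 1 ≠ 0 := by positivity
      rw [F_succ, min_eq_right hm, add_comm 1, div_mul_cancel₀ _ this]
      rfl
    have heq := tendsto_nhds_unique (lim.comp (tendsto_add_atTop_nat 1)) lim'
    have hone : ∑' j, ω t2 j = 1 := mul_left_cancel₀ hle0.ne' (by linarith)
    exact hone ▸ hs.hasSum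
  refine tsum_mul_le_tsum_mul_of_sum_range_le (hω_nonneg t1) (hω_nonneg t2) (F_le_one t1)
    hasSum_one F_antitone ?_ ?_ hsum2
  · rw [hc]
    exact hP.trace_nonneg
  · rw [funext hc]
    exact monotone_trace_iterate hloewner
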